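/- Let (μ_n)_{n≥1} be a sequence of probability measures on ℝ, each with infinite support and all moments finite, with orthonormal polynomial leading coefficients γ_j^{(n)}. Let x* ∈ ℝ and α > 0 be such that n^{2α−1}(γ_{n−1}^{(n)}/γ_n^{(n)})² → 0 as n → ∞. Then for every uniformly continuous bounded f : ℝ → ℝ, the variance of the scaled linear statistic of the OPE of size n associated with μ_n satisfies Var X_{f,α,x*}^{(n)} = o(n) as n → ∞. -/

import Mathlib

open MeasureTheory ProbabilityTheory Filter Topology

noncomputable section

/-- The squared Vandermonde determinant `∏_{i>j} (λ_i - λ_j)^2`. -/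
def vandSq {n : ℕ} (l : Fin n → ℝ) : ℝ :=
  ∏ q ∈ Finset.univ.filter (fun q : Fin n × Fin n => q.2 < q.1), (l q.1 - l q.2) ^ 2

/-- The orthogonal polynomial ensemble of size `n` associated with `μ`: the probability
measure on `ℝ^n` proportional to `∏_{i>j}(λ_i-λ_j)^2 dμ(λ_1)⋯dμ(λ_n)`. -/
def OPE (μ : Measure ℝ) (n : ℕ) : Measure (Fin n → ℝ) :=
  ((((Measure.pi fun _ : Fin n => μ).withDensity fun l => ENNReal.ofReal (vandSq l))
    Set.univ)⁻¹) •
    ((Measure.pi fun _ : Fin n => μ).withDensity fun l => ENNReal.ofReal (vandSq l))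

/-- The linear statistic `X_f = ∑ f(λ_j)`. -/
def linStat {n : ℕ} (f : ℝ → ℝ) (l : Fin n → ℝ) : ℝ := ∑ j, f (l j)

/-- The scaled linear statistic `X_{f,α,x*} = ∑ f(n^α (λ_j - x*))`. -/
def scaledLinStat {n : ℕ} (f : ℝ → ℝ) (α xs : ℝ) (l : Fin n → ℝ) : ℝ :=
  ∑ j, f ((n : ℝ) ^ α * (l j - xs))

/-- `p` is the family of orthonormal polynomials of `μ`: `p j` has degree `j`, positive
leading coefficient, and `∫ p_i p_j dμ = δ_{ij}`. -/
def IsOrthonormalPolys (μ : Measure ℝ) (p : ℕ → Polynomial ℝ) : Prop :=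
  (∀ j, (p j).degree = (j : WithBot ℕ)) ∧ (∀ j, 0 < (p j).leadingCoeff) ∧
    ∀ i j, ∫ x, (p i).eval x * (p j).eval x ∂μ = if i = j then 1 else 0

/-- All moments of `μ` are finite. -/
def HasAllMoments (μ : Measure ℝ) : Prop := ∀ k : ℕ, Integrable (fun x : ℝ => x ^ k) μ

/-- `μ` has infinite support: no finite set carries full `μ`-measure. -/
def InfiniteSupport (μ : Measure ℝ) : Prop := ∀ s : Finset ℝ, μ ((↑s : Set ℝ)ᶜ) ≠ 0

/-- The Christoffel–Darboux kernel `K_n(x,y) = ∑_{j<n} p_j(x) p_j(y)`. -/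
def CDKernel (p : ℕ → Polynomial ℝ) (n : ℕ) (x y : ℝ) : ℝ :=
  ∑ j ∈ Finset.range n, (p j).eval x * (p j).eval y

/-- The sup norm `‖f‖_∞` of a (bounded) function. -/
def supNorm (f : ℝ → ℝ) : ℝ := ⨆ x, |f x|

/-- The (topological) support of a measure on `ℝ`. -/
def measSupport (μ : Measure ℝ) : Set ℝ := {x | ∀ U ∈ 𝓝 x, μ U ≠ 0}

/-- The sine kernel `sin(πt)/(πt)` (equal to `1` at `t = 0`). -/
def sineKernel (t : ℝ) : ℝ := if t = 0 then 1 else Real.sin (Real.pi * t) / (Real.pi * t)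

/-- `K̃_n(x,y) = w(x)^{1/2} w(y)^{1/2} K_n(x,y)`, where `w` is the Radon–Nikodym
derivative of `μ` with respect to Lebesgue measure. -/
def tildeK (μ : Measure ℝ) (Kf : ℝ → ℝ → ℝ) (x y : ℝ) : ℝ :=
  Real.sqrt ((μ.rnDeriv volume x).toReal) * Real.sqrt ((μ.rnDeriv volume y).toReal) * Kf x y

/-- The Nevai condition at `x*` for a sequence of measures with kernels `Kf n`. -/
def NevaiCond (μ : ℕ → Measure ℝ) (Kf : ℕ → ℝ → ℝ → ℝ) (xs : ℝ) : Prop :=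
  ∀ f : ℝ → ℝ, Continuous f → HasCompactSupport f →
    Tendsto (fun n => ∫ y, (f y - f xs) * Kf n xs y ^ 2 / Kf n xs xs ∂(μ n)) atTop (𝓝 0)

/-- The `α`-Nevai condition at `x*` for a sequence of measures with kernels `Kf n`. -/
def AlphaNevaiCond (μ : ℕ → Measure ℝ) (Kf : ℕ → ℝ → ℝ → ℝ) (α xs : ℝ) : Prop :=
  ∀ f : ℝ → ℝ, Continuous f → HasCompactSupport f →
    ∀ S : Set ℝ, IsCompact S →
      TendstoUniformlyOn
        (fun n s => ∫ y, (f s - f ((n : ℝ) ^ α * (y - xs))) *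
            Kf n (xs + s / (n : ℝ) ^ α) y ^ 2 /
            Kf n (xs + s / (n : ℝ) ^ α) (xs + s / (n : ℝ) ^ α) ∂(μ n))
        (fun _ => 0) atTop S

/-- A permutation fixing every point other than `i` and `j` is trivial or swaps them. -/
lemma perm_eq_or_eq_mul_swap {ι : Type*} [DecidableEq ι] {i j : ι} {σ τ : Equiv.Perm ι}
    (h : ∀ k, k ≠ i → k ≠ j → σ k = τ k) : τ = σ ∨ τ = σ * Equiv.swap i j := by
  have key : ∀ k, τ k = σ i ∨ τ k = σ j ∨ τ k = σ k := by
    intro k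
    obtain ⟨m, hm⟩ := σ.surjective (τ k)
    by_cases hi : m = i
    · left; rw [← hm, hi]
    by_cases hj : m = j
    · right; left; rw [← hm, hj]
    have := h m hi hj
    right; right
    have hmk : m = k := τ.injective (by rw [← this, hm])
    rw [← hm, hmk]
  have hij : τ i = τ j → i = j := fun e => τ.injective e
  have hi := key i
  have hj := key j
  by_cases hi' : τ i = σ i
  · left
    ext k
    by_cases hki : k = i
    · rw [hki, hi']
    by_cases hkj : k = j
    · subst hkj
      rcases hj with h1 | h1 | h1
      · exact absurd (τ.injective (hi'.trans h1.symm)).symm hki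
      · exact h1
      · exact h1
    · exact (h k hki hkj).symm
  · right
    have hi2 : τ i = σ j := by tauto
    have hne : i ≠ j := by rintro rfl; exact hi' hi2
    have hj2 : τ j = σ i := by
      have : τ j ≠ σ j := fun e => hne (hij (hi2.trans e.symm))
      tauto
    ext k
    by_cases hki : k = i
    · subst hki; simp [hi2]
    by_cases hkj : k = j
    · subst hkj; simp [hj2]
    · simp [Equiv.swap_apply_of_ne_of_ne hki hkj, (h k hki hkj).symm]

section Permutations

variable {ι : Type*} [Fintype ι] [DecidableEq ι]

lemma sum_sign_mul_prod_of_eq_one_off_pair {i j : ι} (hij : i ≠ j) (B : ι → ι → ι → ℝ)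
    (hB : ∀ k, k ≠ i → k ≠ j → ∀ a b, B k a b = if a = b then 1 else 0) (σ : Equiv.Perm ι) :
    ∑ τ : Equiv.Perm ι, (((σ.sign : ℤ) : ℝ) * ((τ.sign : ℤ) : ℝ)) * ∏ k, B k (σ k) (τ k) =
      B i (σ i) (σ i) * B j (σ j) (σ j) - B i (σ i) (σ j) * B j (σ j) (σ i) := by
  have hne : σ ≠ σ * Equiv.swap i j := by
    intro h
    have := congrArg (fun e : Equiv.Perm ι => e i) h
    simp at this
    exact hij this
  have hs : ((σ.sign : ℤ) : ℝ) * ((σ.sign : ℤ) : ℝ) = 1 := by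
    rcases Int.units_eq_one_or σ.sign with h | h <;> simp [h]
  rw [Fintype.sum_eq_add σ (σ * Equiv.swap i j) hne]
  · rw [Fintype.prod_eq_mul i j hij, Fintype.prod_eq_mul i j hij, hs, Equiv.Perm.sign_mul,
      Equiv.Perm.sign_swap hij]
    · simp only [Equiv.Perm.mul_apply, Equiv.swap_apply_left, Equiv.swap_apply_right]
      push_cast
      linear_combination (-(B i (σ i) (σ j) * B j (σ j) (σ i))) * hs
    · rintro k ⟨h1, h2⟩
      rw [hB k h1 h2, Equiv.Perm.mul_apply, Equiv.swap_apply_of_ne_of_ne h1 h2, if_pos rfl]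
    · rintro k ⟨h1, h2⟩
      rw [hB k h1 h2, if_pos rfl]
  · rintro τ ⟨h1, h2⟩
    have : ∃ k, k ≠ i ∧ k ≠ j ∧ σ k ≠ τ k := by
      by_contra! hc
      rcases perm_eq_or_eq_mul_swap hc with h | h
      · exact h1 h
      · exact h2 h
    obtain ⟨k, hki, hkj, hk⟩ := this
    rw [Finset.prod_eq_zero (Finset.mem_univ k), mul_zero]
    rw [hB k hki hkj, if_neg hk]

lemma sum_sign_mul_prod_of_eq_one_off_point (i : ι) (B : ι → ι → ι → ℝ)
    (hB : ∀ k, k ≠ i → ∀ a b, B k a b = if a = b then 1 else 0) (σ : Equiv.Perm ι) :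
    ∑ τ : Equiv.Perm ι, (((σ.sign : ℤ) : ℝ) * ((τ.sign : ℤ) : ℝ)) * ∏ k, B k (σ k) (τ k) =
      B i (σ i) (σ i) := by
  have hs : ((σ.sign : ℤ) : ℝ) * ((σ.sign : ℤ) : ℝ) = 1 := by
    rcases Int.units_eq_one_or σ.sign with h | h <;> simp [h]
  rw [Fintype.sum_eq_single σ]
  · rw [hs, one_mul, Fintype.prod_eq_single i]
    intro k hk
    rw [hB k hk, if_pos rfl]
  · intro τ hτ
    have : ∃ k, k ≠ i ∧ σ k ≠ τ k := by
      by_contra! hc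
      rcases perm_eq_or_eq_mul_swap (i := i) (j := i) (fun k hk _ => hc k hk) with h | h
      · exact hτ h
      · exact hτ (h.trans (by rw [Equiv.swap_self]; exact mul_one σ))
    obtain ⟨k, hki, hk⟩ := this
    rw [Finset.prod_eq_zero (Finset.mem_univ k), mul_zero]
    rw [hB k hki, if_neg hk]

end Permutations

section Determinantal

variable {ι : Type*} [Fintype ι] [DecidableEq ι]

/-- The squared determinant `det(φ_i(l_j))²`. -/
def detSq (φ : ι → ℝ → ℝ) (l : ι → ℝ) : ℝ := (Matrix.of fun i j => φ i (l j)).det ^ 2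

lemma prod_mul_detSq_eq (φ h : ι → ℝ → ℝ) (l : ι → ℝ) :
    (∏ k, h k (l k)) * detSq φ l =
      ∑ σ : Equiv.Perm ι, ∑ τ : Equiv.Perm ι, (((σ.sign : ℤ) : ℝ) * ((τ.sign : ℤ) : ℝ)) *
        ∏ k, h k (l k) * (φ (σ k) (l k) * φ (τ k) (l k)) := by
  rw [detSq, Matrix.det_apply', sq, Finset.sum_mul_sum, Finset.mul_sum]
  refine Finset.sum_congr rfl fun σ _ => ?_
  rw [Finset.mul_sum]
  refine Finset.sum_congr rfl fun τ _ => ?_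
  simp only [Matrix.of_apply, Finset.prod_mul_distrib]
  ring

variable {μ : Measure ℝ} [SigmaFinite μ] {φ : ι → ℝ → ℝ}

lemma integrable_prod_mul_detSq {h : ι → ℝ → ℝ}
    (hint : ∀ k a b, Integrable (fun x => h k x * (φ a x * φ b x)) μ) :
    Integrable (fun l => (∏ k, h k (l k)) * detSq φ l) (Measure.pi fun _ : ι => μ) := by
  simp only [prod_mul_detSq_eq]
  refine integrable_finsetSum _ fun σ _ => integrable_finsetSum _ fun τ _ => ?_
  exact (Integrable.fintype_prod (f := fun k x => h k x * (φ (σ k) x * φ (τ k) x))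
    fun k => hint k _ _).const_mul _

lemma integral_prod_mul_detSq {h : ι → ℝ → ℝ}
    (hint : ∀ k a b, Integrable (fun x => h k x * (φ a x * φ b x)) μ) :
    ∫ l, (∏ k, h k (l k)) * detSq φ l ∂(Measure.pi fun _ : ι => μ) =
      ∑ σ : Equiv.Perm ι, ∑ τ : Equiv.Perm ι, (((σ.sign : ℤ) : ℝ) * ((τ.sign : ℤ) : ℝ)) *
        ∏ k, ∫ x, h k x * (φ (σ k) x * φ (τ k) x) ∂μ := by
  simp only [prod_mul_detSq_eq]
  have hI : ∀ σ τ : Equiv.Perm ι, Integrable (fun l : ι → ℝ =>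
      (((σ.sign : ℤ) : ℝ) * ((τ.sign : ℤ) : ℝ)) *
        ∏ k, h k (l k) * (φ (σ k) (l k) * φ (τ k) (l k))) (Measure.pi fun _ : ι => μ) :=
    fun σ τ => (Integrable.fintype_prod (f := fun k x => h k x * (φ (σ k) x * φ (τ k) x))
      fun k => hint k _ _).const_mul _
  rw [integral_finsetSum _ fun σ _ => integrable_finsetSum _ fun τ _ => hI σ τ]
  refine Finset.sum_congr rfl fun σ _ => ?_
  rw [integral_finsetSum _ fun τ _ => hI σ τ]
  refine Finset.sum_congr rfl fun τ _ => ?_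
  rw [integral_const_mul,
    integral_fintype_prod_eq_prod (fun k x => h k x * (φ (σ k) x * φ (τ k) x))]

lemma integrable_mul_detSq (hφ : ∀ a b, Integrable (fun x => φ a x * φ b x) μ) {g : ℝ → ℝ}
    (hg : ∀ a b, Integrable (fun x => g x * (φ a x * φ b x)) μ) (i : ι) :
    Integrable (fun l : ι → ℝ => g (l i) * detSq φ l) (Measure.pi fun _ : ι => μ) ∧
      ((∀ a b, ∫ x, φ a x * φ b x ∂μ = if a = b then 1 else 0) →
        ∫ l, g (l i) * detSq φ l ∂(Measure.pi fun _ : ι => μ) =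
          ∑ σ : Equiv.Perm ι, ∫ x, g x * (φ (σ i) x * φ (σ i) x) ∂μ) := by
  set h : ι → ℝ → ℝ := fun k => if k = i then g else 1 with hh
  have hint : ∀ k a b, Integrable (fun x => h k x * (φ a x * φ b x)) μ := by
    intro k a b
    by_cases hk : k = i
    · simpa [hh, hk] using hg a b
    · simpa [hh, hk] using hφ a b
  have hprod : ∀ l : ι → ℝ, (∏ k, h k (l k)) = g (l i) := by
    intro l
    rw [Fintype.prod_eq_single i (by intro k hk; simp [hh, hk])]
    simp [hh]
  constructor
  · simpa only [hprod] using integrable_prod_mul_detSq hint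
  · intro horth
    have := integral_prod_mul_detSq hint
    simp only [hprod] at this
    rw [this]
    refine Finset.sum_congr rfl fun σ _ => ?_
    rw [sum_sign_mul_prod_of_eq_one_off_point i
      (fun k a b => ∫ x, h k x * (φ a x * φ b x) ∂μ)]
    · simp [hh]
    · intro k hk a b
      simpa [hh, hk] using horth a b

lemma integrable_mul_mul_detSq (hφ : ∀ a b, Integrable (fun x => φ a x * φ b x) μ) {g : ℝ → ℝ}
    (hg : ∀ a b, Integrable (fun x => g x * (φ a x * φ b x)) μ) {i j : ι} (hij : i ≠ j) :
    Integrable (fun l : ι → ℝ => g (l i) * g (l j) * detSq φ l) (Measure.pi fun _ : ι => μ) ∧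
      ((∀ a b, ∫ x, φ a x * φ b x ∂μ = if a = b then 1 else 0) →
        ∫ l, g (l i) * g (l j) * detSq φ l ∂(Measure.pi fun _ : ι => μ) =
          ∑ σ : Equiv.Perm ι, ((∫ x, g x * (φ (σ i) x * φ (σ i) x) ∂μ) *
            (∫ x, g x * (φ (σ j) x * φ (σ j) x) ∂μ) -
            (∫ x, g x * (φ (σ i) x * φ (σ j) x) ∂μ) ^ 2)) := by
  set h : ι → ℝ → ℝ := fun k => if k = i ∨ k = j then g else 1 with hh
  have hint : ∀ k a b, Integrable (fun x => h k x * (φ a x * φ b x)) μ := by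
    intro k a b
    by_cases hk : k = i ∨ k = j
    · simpa [hh, hk] using hg a b
    · simpa [hh, hk] using hφ a b
  have hprod : ∀ l : ι → ℝ, (∏ k, h k (l k)) = g (l i) * g (l j) := by
    intro l
    rw [Fintype.prod_eq_mul i j hij (by rintro k ⟨h1, h2⟩; simp [hh, h1, h2])]
    simp [hh]
  constructor
  · simpa only [hprod] using integrable_prod_mul_detSq hint
  · intro horth
    have := integral_prod_mul_detSq hint
    simp only [hprod] at this
    rw [this]
    refine Finset.sum_congr rfl fun σ _ => ?_
    rw [sum_sign_mul_prod_of_eq_one_off_pair hij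
      (fun k a b => ∫ x, h k x * (φ a x * φ b x) ∂μ)]
    · simp only [hh, true_or, or_true, if_true]
      rw [sq]
      simp only [mul_comm (φ (σ j) _) (φ (σ i) _)]
    · intro k hk hk' a b
      simpa [hh, hk, hk'] using horth a b

/-- First and second moments of a linear statistic against `detSq φ`, for orthonormal `φ`. -/
lemma integral_sum_mul_detSq (hφ : ∀ a b, Integrable (fun x => φ a x * φ b x) μ)
    (horth : ∀ a b, ∫ x, φ a x * φ b x ∂μ = if a = b then 1 else 0) {g : ℝ → ℝ}
    (hg : ∀ a b, Integrable (fun x => g x * (φ a x * φ b x)) μ) :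
    ∫ l, (∑ i, g (l i)) * detSq φ l ∂(Measure.pi fun _ : ι => μ) =
      (Fintype.card ι).factorial * ∑ a, ∫ x, g x * (φ a x * φ a x) ∂μ := by
  simp only [Finset.sum_mul]
  rw [integral_finsetSum _ fun i _ => (integrable_mul_detSq hφ hg i).1]
  simp only [(integrable_mul_detSq hφ hg _).2 horth]
  rw [Finset.sum_comm]
  simp only [Equiv.sum_comp _ fun a => ∫ x, g x * (φ a x * φ a x) ∂μ]
  simp [Fintype.card_perm]

lemma integral_sum_sq_mul_detSq (hφ : ∀ a b, Integrable (fun x => φ a x * φ b x) μ)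
    (horth : ∀ a b, ∫ x, φ a x * φ b x ∂μ = if a = b then 1 else 0) {g : ℝ → ℝ}
    (hg : ∀ a b, Integrable (fun x => g x * (φ a x * φ b x)) μ)
    (hg2 : ∀ a b, Integrable (fun x => g x ^ 2 * (φ a x * φ b x)) μ) :
    ∫ l, (∑ i, g (l i)) ^ 2 * detSq φ l ∂(Measure.pi fun _ : ι => μ) =
      (Fintype.card ι).factorial * ((∑ a, ∫ x, g x ^ 2 * (φ a x * φ a x) ∂μ) +
        (∑ a, ∫ x, g x * (φ a x * φ a x) ∂μ) ^ 2 -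
        ∑ a, ∑ b, (∫ x, g x * (φ a x * φ b x) ∂μ) ^ 2) := by
  have hI : ∀ i j, Integrable (fun l : ι → ℝ => g (l i) * g (l j) * detSq φ l)
      (Measure.pi fun _ : ι => μ) := by
    intro i j
    by_cases hij : i = j
    · subst hij
      simpa only [← sq] using (integrable_mul_detSq hφ hg2 i).1
    · exact (integrable_mul_mul_detSq hφ hg hij).1
  set A : ι → ι → ℝ := fun a b => ∫ x, g x * (φ a x * φ b x) ∂μ with hA
  set A2 : ι → ℝ := fun a => ∫ x, g x ^ 2 * (φ a x * φ a x) ∂μ with hA2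
  have hE : ∀ i j, ∫ l, g (l i) * g (l j) * detSq φ l ∂(Measure.pi fun _ : ι => μ) =
      ∑ σ : Equiv.Perm ι, ((if σ i = σ j then A2 (σ i) else 0) +
        (A (σ i) (σ i) * A (σ j) (σ j) - A (σ i) (σ j) ^ 2)) := by
    intro i j
    by_cases hij : i = j
    · subst hij
      have := (integrable_mul_detSq hφ hg2 i).2 horth
      simp only [← sq] at this ⊢
      rw [this]
      refine Finset.sum_congr rfl fun σ _ => ?_
      simp [hA2, sq]
    · rw [(integrable_mul_mul_detSq hφ hg hij).2 horth]
      refine Finset.sum_congr rfl fun σ _ => ?_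
      rw [if_neg (fun h => hij (σ.injective h)), zero_add]
  simp only [sq (∑ i, g _), Finset.sum_mul_sum]
  simp only [Finset.sum_mul]
  rw [integral_finsetSum _ fun i _ => integrable_finsetSum _ fun j _ => hI i j]
  simp only [integral_finsetSum _ fun j _ => hI _ j, hE]
  have hcomm : ∀ F : Equiv.Perm ι → ι → ι → ℝ, ∑ i, ∑ j, ∑ σ, F σ i j = ∑ σ, ∑ i, ∑ j, F σ i j := by
    intro F
    rw [Finset.sum_comm]
    simp only [Finset.sum_comm (s := (Finset.univ : Finset ι)) (t := (Finset.univ : Finset (Equiv.Perm ι)))]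
    refine Finset.sum_congr rfl fun σ _ => Finset.sum_comm
  rw [hcomm]
  have hσ : ∀ σ : Equiv.Perm ι, (∑ i, ∑ j, ((if σ i = σ j then A2 (σ i) else 0) +
        (A (σ i) (σ i) * A (σ j) (σ j) - A (σ i) (σ j) ^ 2))) =
      (∑ a, A2 a) + (∑ a, A a a) ^ 2 - ∑ a, ∑ b, A a b ^ 2 := by
    intro σ
    have h1 : ∀ i, (∑ j, ((if σ i = σ j then A2 (σ i) else 0) +
        (A (σ i) (σ i) * A (σ j) (σ j) - A (σ i) (σ j) ^ 2))) =
        ∑ b, ((if σ i = b then A2 (σ i) else 0) + (A (σ i) (σ i) * A b b - A (σ i) b ^ 2)) :=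
      fun i => Equiv.sum_comp σ fun b =>
        ((if σ i = b then A2 (σ i) else 0) + (A (σ i) (σ i) * A b b - A (σ i) b ^ 2))
    simp only [h1]
    rw [Equiv.sum_comp σ fun a =>
      ∑ b, ((if a = b then A2 a else 0) + (A a a * A b b - A a b ^ 2))]
    simp only [Finset.sum_add_distrib, Finset.sum_sub_distrib, Finset.sum_ite_eq, Finset.mem_univ,
      if_true, sq (∑ a, A a a), Finset.sum_mul_sum]
    ring
  simp only [hσ]
  rw [Finset.sum_const, Finset.card_univ, Fintype.card_perm, nsmul_eq_mul]

end Determinantal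

section Kernel

variable {ι : Type*} [Fintype ι]

/-- The variance of the linear statistic of `h` in the determinantal process of the orthonormal
family `φ`, in terms of the truncated multiplication operator by `h`. -/
def truncVar (μ : Measure ℝ) (φ : ι → ℝ → ℝ) (h : ℝ → ℝ) : ℝ :=
  (∑ a, ∫ x, h x ^ 2 * (φ a x * φ a x) ∂μ) - ∑ a, ∑ b, (∫ x, h x * (φ a x * φ b x) ∂μ) ^ 2

variable {μ : Measure ℝ} {φ : ι → ℝ → ℝ}

lemma mul_mul_sum_sq_eq (φ : ι → ℝ → ℝ) (u v : ℝ → ℝ) (z : ℝ × ℝ) :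
    u z.1 * v z.2 * (∑ a, φ a z.1 * φ a z.2) ^ 2 =
      ∑ a, ∑ b, (u z.1 * (φ a z.1 * φ b z.1)) * (v z.2 * (φ a z.2 * φ b z.2)) := by
  rw [sq, Finset.sum_mul_sum, Finset.mul_sum]
  refine Finset.sum_congr rfl fun a _ => ?_
  rw [Finset.mul_sum]
  exact Finset.sum_congr rfl fun b _ => by ring

lemma integrable_mul_mul_kernel_sq {u v : ℝ → ℝ}
    (hu : ∀ a b, Integrable (fun x => u x * (φ a x * φ b x)) μ)
    (hv : ∀ a b, Integrable (fun x => v x * (φ a x * φ b x)) μ) :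
    Integrable (fun z : ℝ × ℝ => u z.1 * v z.2 * (∑ a, φ a z.1 * φ a z.2) ^ 2) (μ.prod μ) := by
  simp only [mul_mul_sum_sq_eq]
  exact integrable_finsetSum _ fun a _ => integrable_finsetSum _ fun b _ =>
    (hu a b).mul_prod (hv a b)

variable [SigmaFinite μ]

lemma integral_mul_mul_kernel_sq {u v : ℝ → ℝ}
    (hu : ∀ a b, Integrable (fun x => u x * (φ a x * φ b x)) μ)
    (hv : ∀ a b, Integrable (fun x => v x * (φ a x * φ b x)) μ) :
    ∫ z : ℝ × ℝ, u z.1 * v z.2 * (∑ a, φ a z.1 * φ a z.2) ^ 2 ∂(μ.prod μ) =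
      ∑ a, ∑ b, (∫ x, u x * (φ a x * φ b x) ∂μ) * ∫ x, v x * (φ a x * φ b x) ∂μ := by
  simp only [mul_mul_sum_sq_eq]
  rw [integral_finsetSum _ fun a _ => integrable_finsetSum _ fun b _ => (hu a b).mul_prod (hv a b)]
  refine Finset.sum_congr rfl fun a _ => ?_
  rw [integral_finsetSum _ fun b _ => (hu a b).mul_prod (hv a b)]
  refine Finset.sum_congr rfl fun b _ => ?_
  exact integral_prod_mul (fun x => u x * (φ a x * φ b x)) (fun x => v x * (φ a x * φ b x))

lemma integral_sub_sq_mul_kernel_sq [DecidableEq ι]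
    (hφ : ∀ a b, Integrable (fun x => φ a x * φ b x) μ)
    (horth : ∀ a b, ∫ x, φ a x * φ b x ∂μ = if a = b then 1 else 0) {h : ℝ → ℝ}
    (hh : ∀ a b, Integrable (fun x => h x * (φ a x * φ b x)) μ)
    (hh2 : ∀ a b, Integrable (fun x => h x ^ 2 * (φ a x * φ b x)) μ) :
    Integrable (fun z : ℝ × ℝ => (h z.1 - h z.2) ^ 2 * (∑ a, φ a z.1 * φ a z.2) ^ 2) (μ.prod μ) ∧
      ∫ z : ℝ × ℝ, (h z.1 - h z.2) ^ 2 * (∑ a, φ a z.1 * φ a z.2) ^ 2 ∂(μ.prod μ) =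
        2 * truncVar μ φ h := by
  have h1 : ∀ a b, Integrable (fun x => (1 : ℝ) * (φ a x * φ b x)) μ := by simpa using hφ
  have e : ∀ z : ℝ × ℝ, (h z.1 - h z.2) ^ 2 * (∑ a, φ a z.1 * φ a z.2) ^ 2 =
      h z.1 ^ 2 * 1 * (∑ a, φ a z.1 * φ a z.2) ^ 2 + 1 * h z.2 ^ 2 * (∑ a, φ a z.1 * φ a z.2) ^ 2
        - 2 * (h z.1 * h z.2 * (∑ a, φ a z.1 * φ a z.2) ^ 2) := fun z => by ring
  simp only [e]
  have i1 := integrable_mul_mul_kernel_sq (u := fun x => h x ^ 2) (v := fun _ => 1) hh2 h1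
  have i2 := integrable_mul_mul_kernel_sq (u := fun _ => 1) (v := fun x => h x ^ 2) h1 hh2
  have i3 := integrable_mul_mul_kernel_sq hh hh
  have i12 : Integrable (fun z : ℝ × ℝ => h z.1 ^ 2 * 1 * (∑ a, φ a z.1 * φ a z.2) ^ 2 +
      1 * h z.2 ^ 2 * (∑ a, φ a z.1 * φ a z.2) ^ 2) (μ.prod μ) := i1.add i2
  refine ⟨i12.sub (i3.const_mul 2), ?_⟩
  rw [integral_sub i12 (i3.const_mul 2), integral_const_mul, integral_add i1 i2,
    integral_mul_mul_kernel_sq (u := fun x => h x ^ 2) (v := fun _ => 1) hh2 h1,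
    integral_mul_mul_kernel_sq (u := fun _ => 1) (v := fun x => h x ^ 2) h1 hh2,
    integral_mul_mul_kernel_sq hh hh]
  simp only [one_mul, horth, truncVar, ← sq, mul_ite, ite_mul, mul_one, mul_zero, zero_mul,
    Finset.sum_ite_eq, Finset.mem_univ, if_true]
  ring

lemma truncVar_le_of_sub_sq_le [DecidableEq ι]
    (hφ : ∀ a b, Integrable (fun x => φ a x * φ b x) μ)
    (horth : ∀ a b, ∫ x, φ a x * φ b x ∂μ = if a = b then 1 else 0) {g h : ℝ → ℝ}
    (hg : ∀ a b, Integrable (fun x => g x * (φ a x * φ b x)) μ)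
    (hg2 : ∀ a b, Integrable (fun x => g x ^ 2 * (φ a x * φ b x)) μ)
    (hh : ∀ a b, Integrable (fun x => h x * (φ a x * φ b x)) μ)
    (hh2 : ∀ a b, Integrable (fun x => h x ^ 2 * (φ a x * φ b x)) μ) {ε C : ℝ}
    (hle : ∀ x y, (g x - g y) ^ 2 ≤ ε + C * (h x - h y) ^ 2) :
    truncVar μ φ g ≤ ε / 2 * Fintype.card ι + C * truncVar μ φ h := by
  have h1 : ∀ a b, Integrable (fun x => (1 : ℝ) * (φ a x * φ b x)) μ := by simpa using hφ
  obtain ⟨ig, eg⟩ := integral_sub_sq_mul_kernel_sq hφ horth hg hg2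
  obtain ⟨ih, eh⟩ := integral_sub_sq_mul_kernel_sq hφ horth hh hh2
  have i1 := integrable_mul_mul_kernel_sq (u := fun _ => 1) (v := fun _ => 1) h1 h1
  have e1 := integral_mul_mul_kernel_sq (u := fun _ => 1) (v := fun _ => 1) h1 h1
  simp only [one_mul, horth, mul_ite, mul_one, mul_zero, Finset.sum_ite_eq,
    Finset.mem_univ, if_true, Finset.sum_const, Finset.card_univ, nsmul_eq_mul] at i1 e1
  have key := integral_mono ig ((i1.const_mul ε).add (ih.const_mul C)) (fun z => by
    have := mul_le_mul_of_nonneg_right (hle z.1 z.2) (sq_nonneg (∑ a, φ a z.1 * φ a z.2))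
    simp only [Pi.add_apply]
    linarith)
  simp only [Pi.add_apply] at key
  rw [integral_add (i1.const_mul ε) (ih.const_mul C), integral_const_mul, integral_const_mul,
    eg, eh, e1] at key
  linarith

end Kernel

section Polynomials

variable {μ : Measure ℝ} {p : ℕ → Polynomial ℝ}

lemma HasAllMoments.integrable_eval (hm : HasAllMoments μ) (q : Polynomial ℝ) :
    Integrable (fun x => q.eval x) μ := by
  simp only [Polynomial.eval_eq_sum_range]
  exact integrable_finsetSum _ fun k _ => (hm k).const_mul _

lemma IsOrthonormalPolys.coeff_self (hp : IsOrthonormalPolys μ p) (j : ℕ) :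
    (p j).coeff j = (p j).leadingCoeff := by
  rw [Polynomial.leadingCoeff, Polynomial.natDegree_eq_of_degree_eq_some (hp.1 j)]

lemma IsOrthonormalPolys.exists_eq_sum (hp : IsOrthonormalPolys μ p) (m : ℕ) (q : Polynomial ℝ)
    (hq : q.degree < m) : ∃ c : ℕ → ℝ, q = ∑ b ∈ Finset.range m, Polynomial.C (c b) * p b := by
  induction m generalizing q with
  | zero => exact ⟨0, by simpa [Polynomial.degree_lt_iff_coeff_zero, Polynomial.ext_iff] using hq⟩
  | succ m ih =>
    set d := q.coeff m / (p m).leadingCoeff with hd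
    obtain ⟨c, hc⟩ := ih (q - Polynomial.C d * p m) (by
      rw [Polynomial.degree_lt_iff_coeff_zero] at hq ⊢
      intro k hk
      rcases hk.eq_or_lt with rfl | hk
      · rw [Polynomial.coeff_sub, Polynomial.coeff_C_mul, hp.coeff_self, hd,
          div_mul_cancel₀ _ (hp.2.1 m).ne', sub_self]
      · rw [Polynomial.coeff_sub, Polynomial.coeff_C_mul, hq k hk,
          Polynomial.coeff_eq_zero_of_degree_lt (by rw [hp.1 m]; exact_mod_cast hk)]
        simp)
    refine ⟨fun b => if b = m then d else c b, ?_⟩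
    simp only [Finset.sum_range_succ, if_true]
    rw [← sub_eq_iff_eq_add, hc]
    refine Finset.sum_congr rfl fun b hb => ?_
    rw [if_neg (Finset.mem_range.1 hb).ne]

lemma IsOrthonormalPolys.integral_sum_mul (hm : HasAllMoments μ) (hp : IsOrthonormalPolys μ p)
    (m : ℕ) (c : ℕ → ℝ) {b : ℕ} (hb : b < m) :
    ∫ x, (∑ a ∈ Finset.range m, Polynomial.C (c a) * p a).eval x * (p b).eval x ∂μ = c b := by
  simp only [Polynomial.eval_finsetSum, Polynomial.eval_mul, Polynomial.eval_C, Finset.sum_mul,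
    mul_assoc]
  rw [integral_finsetSum _ fun a _ => Integrable.const_mul
    (by simpa using hm.integrable_eval (p a * p b)) _]
  simp only [integral_const_mul, hp.2.2]
  simp [hb]

/-- Parseval's identity for a polynomial of degree less than `m`. -/
lemma IsOrthonormalPolys.integral_sq_eq (hm : HasAllMoments μ) (hp : IsOrthonormalPolys μ p)
    (m : ℕ) (q : Polynomial ℝ) (hq : q.degree < m) :
    ∫ x, q.eval x * q.eval x ∂μ =
      ∑ b ∈ Finset.range m, (∫ x, q.eval x * (p b).eval x ∂μ) ^ 2 := by
  obtain ⟨c, hc⟩ := hp.exists_eq_sum m q hq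
  have h1 : ∀ b ∈ Finset.range m, ∫ x, q.eval x * (p b).eval x ∂μ = c b := by
    intro b hb
    rw [hc]
    exact hp.integral_sum_mul hm m c (Finset.mem_range.1 hb)
  have h2 : ∀ x, q.eval x * q.eval x =
      ∑ b ∈ Finset.range m, c b * (q.eval x * (p b).eval x) := by
    intro x
    conv_lhs => enter [2]; rw [hc]
    simp only [Polynomial.eval_finsetSum, Polynomial.eval_mul, Polynomial.eval_C, Finset.mul_sum]
    exact Finset.sum_congr rfl fun b _ => by ring
  simp only [h2]
  rw [integral_finsetSum _ fun a _ => Integrable.const_mul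
    (by simpa using hm.integrable_eval (q * p a)) _]
  refine Finset.sum_congr rfl fun b hb => ?_
  rw [integral_const_mul, h1 b hb, sq]

lemma IsOrthonormalPolys.integral_mul_top (hm : HasAllMoments μ) (hp : IsOrthonormalPolys μ p)
    (m : ℕ) (q : Polynomial ℝ) (hq : q.degree < (m + 1 : ℕ)) :
    ∫ x, q.eval x * (p m).eval x ∂μ = q.coeff m / (p m).leadingCoeff := by
  obtain ⟨c, hc⟩ := hp.exists_eq_sum (m + 1) q hq
  have h1 : q.coeff m = c m * (p m).leadingCoeff := by
    rw [hc, Finset.sum_range_succ, Polynomial.coeff_add, Polynomial.coeff_C_mul, hp.coeff_self,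
      Polynomial.finsetSum_coeff, Finset.sum_eq_zero, zero_add]
    intro b hb
    rw [Polynomial.coeff_C_mul, Polynomial.coeff_eq_zero_of_degree_lt, mul_zero]
    rw [hp.1 b]
    exact_mod_cast Finset.mem_range.1 hb
  rw [h1, mul_div_cancel_right₀ _ (hp.2.1 m).ne', hc,
    hp.integral_sum_mul hm (m + 1) c (Nat.lt_succ_self m)]

lemma IsOrthonormalPolys.truncVar_id (hm : HasAllMoments μ) (hp : IsOrthonormalPolys μ p)
    (m : ℕ) :
    truncVar μ (fun (i : Fin (m + 1)) x => (p i).eval x) (fun x => x) =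
      ((p m).leadingCoeff / (p (m + 1)).leadingCoeff) ^ 2 := by
  have hdeg : ∀ a < m + 1, (Polynomial.X * p a).degree < ((m + 1 + 1 : ℕ) : WithBot ℕ) := by
    intro a ha
    rw [Polynomial.degree_mul, Polynomial.degree_X, hp.1 a]
    norm_cast
    omega
  have h1 : ∀ a < m + 1, ∫ x, x ^ 2 * ((p a).eval x * (p a).eval x) ∂μ =
      (∑ b ∈ Finset.range (m + 1), (∫ x, x * ((p a).eval x * (p b).eval x) ∂μ) ^ 2) +
        ((p a).coeff m / (p (m + 1)).leadingCoeff) ^ 2 := by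
    intro a ha
    have e := hp.integral_sq_eq hm _ _ (hdeg a ha)
    rw [Finset.sum_range_succ, hp.integral_mul_top hm _ _ (hdeg a ha),
      Polynomial.coeff_X_mul] at e
    simp only [Polynomial.eval_mul, Polynomial.eval_X] at e
    simp only [mul_assoc] at e ⊢
    rw [← e]
    exact integral_congr_ae (ae_of_all _ fun x => by ring)
  unfold truncVar
  rw [Fin.sum_univ_eq_sum_range (fun a => ∫ x, x ^ 2 * ((p a).eval x * (p a).eval x) ∂μ),
    Finset.sum_congr rfl fun a ha => h1 a (Finset.mem_range.1 ha), Finset.sum_add_distrib,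
    Fin.sum_univ_eq_sum_range
      (fun a => ∑ b : Fin (m + 1), (∫ x, x * ((p a).eval x * (p b).eval x) ∂μ) ^ 2)]
  simp only [fun a => Fin.sum_univ_eq_sum_range
      (fun b => (∫ x, x * ((p a).eval x * (p b).eval x) ∂μ) ^ 2) (m + 1)]
  rw [add_sub_cancel_left, Finset.sum_range_succ, hp.coeff_self, Finset.sum_eq_zero, zero_add]
  intro a ha
  rw [Polynomial.coeff_eq_zero_of_degree_lt, zero_div, zero_pow two_ne_zero]
  rw [hp.1 a]
  exact_mod_cast Finset.mem_range.1 ha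

end Polynomials

section Ensemble

lemma vandSq_eq_det_sq {n : ℕ} (l : Fin n → ℝ) : vandSq l = (Matrix.vandermonde l).det ^ 2 := by
  rw [vandSq, Finset.prod_pow, Matrix.det_vandermonde, Finset.prod_filter, Fintype.prod_prod_type,
    Finset.prod_comm]
  congr 1
  refine Finset.prod_congr rfl fun i _ => ?_
  rw [← Finset.prod_filter]
  exact Finset.prod_congr (by ext j; simp) fun _ _ => rfl

lemma vandSq_nonneg {n : ℕ} (l : Fin n → ℝ) : 0 ≤ vandSq l :=
  Finset.prod_nonneg fun _ _ => sq_nonneg _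

lemma measurable_vandSq {n : ℕ} : Measurable (vandSq : (Fin n → ℝ) → ℝ) := by
  unfold vandSq
  fun_prop

variable {μ : Measure ℝ} {p : ℕ → Polynomial ℝ}

lemma IsOrthonormalPolys.exists_detSq_eq (hp : IsOrthonormalPolys μ p) (n : ℕ) :
    ∃ c : ℝ, 0 < c ∧ ∀ l : Fin n → ℝ, detSq (fun (i : Fin n) x => (p i).eval x) l = c * vandSq l := by
  refine ⟨(∏ i : Fin n, (p i).leadingCoeff) ^ 2,
    pow_pos (Finset.prod_pos fun (i : Fin n) _ => hp.2.1 i) 2, fun l => ?_⟩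
  have h := Matrix.eval_matrixOfPolynomials_eq_vandermonde_mul_matrixOfPolynomials l
    (fun i : Fin n => p i)
    fun i => (Polynomial.natDegree_eq_of_degree_eq_some (hp.1 i)).le
  have ht : (Matrix.of fun i j : Fin n => (p j).coeff i).det =
      ∏ i : Fin n, (p i).leadingCoeff := by
    rw [Matrix.det_of_isUpperTriangular]
    · exact Finset.prod_congr rfl fun i _ => hp.coeff_self i
    · intro i j hij
      exact Polynomial.coeff_eq_zero_of_degree_lt (by rw [hp.1 j]; exact_mod_cast hij)
  have hd : (Matrix.of fun i j : Fin n => (p i).eval (l j)) =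
      (Matrix.of fun i j : Fin n => (p j).eval (l i)).transpose := rfl
  rw [detSq, hd, Matrix.det_transpose, h, Matrix.det_mul, ht, vandSq_eq_det_sq]
  ring

lemma HasAllMoments.integrable_mul_eval (hm : HasAllMoments μ) {g : ℝ → ℝ}
    (hg : Measurable g) {C : ℝ} (hC : ∀ x, |g x| ≤ C) (q r : Polynomial ℝ) :
    Integrable (fun x => g x * (q.eval x * r.eval x)) μ :=
  Integrable.bdd_mul (by simpa using hm.integrable_eval (q * r)) hg.aestronglyMeasurable
    (ae_of_all _ hC)

lemma IsOrthonormalPolys.integral_OPE [IsProbabilityMeasure μ] (hm : HasAllMoments μ)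
    (hp : IsOrthonormalPolys μ p) (m : ℕ) :
    IsProbabilityMeasure (OPE μ (m + 1)) ∧ ∀ F : (Fin (m + 1) → ℝ) → ℝ,
      ∫ l, F l ∂(OPE μ (m + 1)) = ((m + 1).factorial : ℝ)⁻¹ *
        ∫ l, F l * detSq (fun (i : Fin (m + 1)) x => (p i).eval x) l
          ∂(Measure.pi fun _ : Fin (m + 1) => μ) := by
  obtain ⟨c, hc, hD⟩ := hp.exists_detSq_eq (m + 1)
  set φ : Fin (m + 1) → ℝ → ℝ := fun i x => (p i).eval x with hφdef
  set ν := Measure.pi fun _ : Fin (m + 1) => μ with hν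
  have hφ : ∀ a b, Integrable (fun x => φ a x * φ b x) μ := fun a b => by
    simpa [hφdef] using hm.integrable_eval (p a * p b)
  have horth : ∀ a b, ∫ x, φ a x * φ b x ∂μ = if a = b then 1 else 0 := fun a b => by
    simpa [Fin.ext_iff] using hp.2.2 a b
  have h1 : ∀ a b, Integrable (fun x => (1 : ℝ) * (φ a x * φ b x)) μ := by simpa using hφ
  obtain ⟨hI, hE⟩ := integrable_mul_detSq (g := fun _ => 1) hφ h1 0
  replace hE := hE horth
  simp only [one_mul, horth, if_true] at hI hE
  rw [Finset.sum_const, Finset.card_univ, Fintype.card_perm, Fintype.card_fin, nsmul_eq_mul,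
    mul_one] at hE
  have hvand : ∀ l : Fin (m + 1) → ℝ, vandSq l = c⁻¹ * detSq φ l := fun l => by
    rw [hD, inv_mul_cancel_left₀ hc.ne']
  have hfac : (0 : ℝ) < (m + 1).factorial := by exact_mod_cast Nat.factorial_pos _
  have hmass : (ν.withDensity fun l => ENNReal.ofReal (vandSq l)) Set.univ =
      ENNReal.ofReal (c⁻¹ * (m + 1).factorial) := by
    rw [withDensity_apply _ MeasurableSet.univ, Measure.restrict_univ,
      ← ofReal_integral_eq_lintegral_ofReal _ (ae_of_all _ vandSq_nonneg)]
    · simp only [hvand]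
      rw [integral_const_mul, hE]
    · exact (hI.const_mul _).congr (ae_of_all _ fun l => (hvand l).symm)
  have hpos : 0 < c⁻¹ * ((m + 1).factorial : ℝ) := by positivity
  refine ⟨⟨?_⟩, fun F => ?_⟩
  · rw [OPE, Measure.smul_apply, ← hν, hmass, smul_eq_mul, ENNReal.inv_mul_cancel]
    · simpa using hpos
    · exact ENNReal.ofReal_ne_top
  · rw [OPE, integral_smul_measure, ← hν, hmass,
      integral_withDensity_eq_integral_toReal_smul measurable_vandSq.ennreal_ofReal
        (ae_of_all _ fun _ => ENNReal.ofReal_lt_top)]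
    simp only [ENNReal.toReal_ofReal (vandSq_nonneg _), ENNReal.toReal_inv,
      ENNReal.toReal_ofReal hpos.le, smul_eq_mul]
    simp only [hvand]
    have : ∀ l, c⁻¹ * detSq φ l * F l = c⁻¹ * (F l * detSq φ l) := fun l => by ring
    simp only [this]
    rw [integral_const_mul]
    field_simp

/-- The variance of a bounded linear statistic in an orthogonal polynomial ensemble. -/
lemma IsOrthonormalPolys.variance_linStat [IsProbabilityMeasure μ] (hm : HasAllMoments μ)
    (hp : IsOrthonormalPolys μ p) (m : ℕ) {g : ℝ → ℝ} (hg : Measurable g) {C : ℝ}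
    (hC : ∀ x, |g x| ≤ C) :
    variance (fun l : Fin (m + 1) → ℝ => linStat g l) (OPE μ (m + 1)) =
      truncVar μ (fun (i : Fin (m + 1)) x => (p i).eval x) g := by
  obtain ⟨hprob, hint⟩ := hp.integral_OPE hm m
  set φ : Fin (m + 1) → ℝ → ℝ := fun i x => (p i).eval x with hφdef
  have hφ : ∀ a b, Integrable (fun x => φ a x * φ b x) μ := fun a b => by
    simpa [hφdef] using hm.integrable_eval (p a * p b)
  have horth : ∀ a b, ∫ x, φ a x * φ b x ∂μ = if a = b then 1 else 0 := fun a b => by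
    simpa [Fin.ext_iff] using hp.2.2 a b
  have hg1 : ∀ a b, Integrable (fun x => g x * (φ a x * φ b x)) μ := fun a b =>
    hm.integrable_mul_eval hg hC (p a) (p b)
  have hg2 : ∀ a b, Integrable (fun x => g x ^ 2 * (φ a x * φ b x)) μ := fun a b =>
    hm.integrable_mul_eval (hg.pow_const 2) (C := C ^ 2)
      (fun x => by rw [abs_pow]; exact pow_le_pow_left₀ (abs_nonneg _) (hC x) 2) (p a) (p b)
  have hL2 : MemLp (fun l : Fin (m + 1) → ℝ => linStat g l) 2 (OPE μ (m + 1)) := by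
    unfold linStat
    refine memLp_finsetSum _ fun i _ => ?_
    exact MemLp.of_bound (hg.comp (measurable_pi_apply i)).aestronglyMeasurable C
      (ae_of_all _ fun l => hC (l i))
  have hfac : ((m + 1).factorial : ℝ) ≠ 0 := by exact_mod_cast Nat.factorial_ne_zero _
  rw [variance_eq_sub hL2]
  simp only [Pi.pow_apply, hint, linStat]
  rw [integral_sum_mul_detSq hφ horth hg1, integral_sum_sq_mul_detSq hφ horth hg1 hg2,
    Fintype.card_fin, inv_mul_cancel_left₀ hfac, inv_mul_cancel_left₀ hfac, truncVar]
  ring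

lemma IsOrthonormalPolys.variance_linStat_le [IsProbabilityMeasure μ] (hm : HasAllMoments μ)
    (hp : IsOrthonormalPolys μ p) (m : ℕ) {g : ℝ → ℝ} (hg : Measurable g) {C : ℝ}
    (hC : ∀ x, |g x| ≤ C) {ε K : ℝ} (hle : ∀ x y, (g x - g y) ^ 2 ≤ ε + K * (x - y) ^ 2) :
    variance (fun l : Fin (m + 1) → ℝ => linStat g l) (OPE μ (m + 1)) ≤
      ε / 2 * (m + 1 : ℕ) + K * ((p m).leadingCoeff / (p (m + 1)).leadingCoeff) ^ 2 := by
  rw [hp.variance_linStat hm m hg hC, ← hp.truncVar_id hm m]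
  have := truncVar_le_of_sub_sq_le (μ := μ) (φ := fun (i : Fin (m + 1)) x => (p i).eval x)
    (g := g) (h := fun x => x) (ε := ε) (C := K)
    (fun a b => by simpa using hm.integrable_eval (p a * p b))
    (fun a b => by simpa [Fin.ext_iff] using hp.2.2 a b)
    (fun a b => hm.integrable_mul_eval hg hC (p a) (p b))
    (fun a b => hm.integrable_mul_eval (hg.pow_const 2) (C := C ^ 2)
      (fun x => by rw [abs_pow]; exact pow_le_pow_left₀ (abs_nonneg _) (hC x) 2) (p a) (p b))
    (fun a b =>
      (hm.integrable_eval (Polynomial.X * (p a * p b))).congr (ae_of_all _ fun x => by simp))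
    (fun a b =>
      (hm.integrable_eval (Polynomial.X ^ 2 * (p a * p b))).congr (ae_of_all _ fun x => by simp)) hle
  simpa using this

end Ensemble

lemma UniformContinuous.exists_sub_sq_le {f : ℝ → ℝ} (hf : UniformContinuous f) {C : ℝ}
    (hC : ∀ x, |f x| ≤ C) {ε : ℝ} (hε : 0 < ε) :
    ∃ K : ℝ, 0 ≤ K ∧ ∀ x y, (f x - f y) ^ 2 ≤ ε + K * (x - y) ^ 2 := by
  obtain ⟨δ, hδ, h⟩ := Metric.uniformContinuous_iff.1 hf (√ε) (Real.sqrt_pos.2 hε)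
  refine ⟨(2 * C) ^ 2 / δ ^ 2, by positivity, fun x y => ?_⟩
  by_cases hxy : dist x y < δ
  · have h1 := h hxy
    rw [Real.dist_eq] at h1
    have h2 : (f x - f y) ^ 2 ≤ ε := by
      rw [← sq_abs, ← Real.sq_sqrt hε.le]
      exact pow_le_pow_left₀ (abs_nonneg _) h1.le 2
    have : 0 ≤ (2 * C) ^ 2 / δ ^ 2 * (x - y) ^ 2 := by positivity
    linarith
  · rw [not_lt, Real.dist_eq] at hxy
    have h1 : (f x - f y) ^ 2 ≤ (2 * C) ^ 2 := by
      rw [← sq_abs]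
      refine pow_le_pow_left₀ (abs_nonneg _) ((abs_sub _ _).trans ?_) 2
      linarith [hC x, hC y]
    have h2 : δ ^ 2 ≤ (x - y) ^ 2 := by
      rw [← sq_abs (x - y)]
      exact pow_le_pow_left₀ hδ.le hxy 2
    have h3 : (2 * C) ^ 2 ≤ (2 * C) ^ 2 / δ ^ 2 * (x - y) ^ 2 := by
      rw [div_mul_eq_mul_div, le_div_iff₀ (by positivity)]
      exact mul_le_mul_of_nonneg_left h2 (sq_nonneg _)
    linarith

/-- **Mesoscopic variance is `o(n)`** (Proposition 4.3): if
`n^{2α-1}(γ_{n-1}^{(n)}/γ_n^{(n)})² → 0`, then for every uniformly continuous bounded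
`f`, any `x* ∈ ℝ`, `Var X_{f,α,x*}^{(n)} = o(n)` as `n → ∞`. -/
theorem variance_little_o_mesoscopic
    (μ : ℕ → Measure ℝ) (hprob : ∀ n, IsProbabilityMeasure (μ n))
    (hinf : ∀ n, InfiniteSupport (μ n)) (hmom : ∀ n, HasAllMoments (μ n))
    (p : ℕ → ℕ → Polynomial ℝ) (hp : ∀ n, IsOrthonormalPolys (μ n) (p n))
    (xs : ℝ) (α : ℝ) (hα : 0 < α)
    (hγ : Tendsto (fun n : ℕ =>
        (n : ℝ) ^ (2 * α - 1) * ((p n (n - 1)).leadingCoeff / (p n n).leadingCoeff) ^ 2)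
      atTop (𝓝 0))
    (f : ℝ → ℝ) (hf : UniformContinuous f) (hfb : ∃ C : ℝ, ∀ x, |f x| ≤ C) :
    Tendsto (fun n : ℕ =>
        variance (fun l : Fin n → ℝ => scaledLinStat f α xs l) (OPE (μ n) n) / n)
      atTop (𝓝 0) := by
  obtain ⟨C, hC⟩ := hfb
  rw [Metric.tendsto_atTop]
  intro ε hε
  obtain ⟨K, hK, hle⟩ := hf.exists_sub_sq_le hC hε
  have hlim := hγ.const_mul K
  rw [mul_zero] at hlim
  obtain ⟨N, hN⟩ := Filter.eventually_atTop.1 (hlim.eventually (gt_mem_nhds (half_pos hε)))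
  refine ⟨N + 1, fun n hn => ?_⟩
  obtain ⟨m, rfl⟩ : ∃ m, n = m + 1 := ⟨n - 1, by omega⟩
  have hNn := hN (m + 1) (by omega)
  set t : ℝ := ((m + 1 : ℕ) : ℝ) with ht
  have htpos : 0 < t := by rw [ht]; positivity
  have := hprob (m + 1)
  have hbound := (hp (m + 1)).variance_linStat_le (hmom (m + 1)) m
    (g := fun x => f (t ^ α * (x - xs))) (C := C) (ε := ε) (K := K * t ^ (2 * α))
    (hf.continuous.measurable.comp (by fun_prop)) (fun x => hC _) (fun x y => by
      refine (hle _ _).trans (le_of_eq ?_)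
      have : t ^ (2 * α) = (t ^ α) ^ 2 := by
        rw [mul_comm, Real.rpow_mul htpos.le, Real.rpow_two]
      rw [this]
      ring)
  change variance (fun l : Fin (m + 1) → ℝ => scaledLinStat f α xs l) (OPE (μ (m + 1)) (m + 1)) ≤ _
    at hbound
  have hv := variance_nonneg (fun l : Fin (m + 1) → ℝ => scaledLinStat f α xs l)
    (OPE (μ (m + 1)) (m + 1))
  rw [Real.dist_eq, sub_zero, abs_of_nonneg (div_nonneg hv htpos.le), div_lt_iff₀ htpos]
  refine hbound.trans_lt ?_
  rw [Real.rpow_sub_one htpos.ne', Nat.add_sub_cancel] at hNn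
  have := mul_lt_mul_of_pos_right hNn htpos
  field_simp at this ⊢
  linarith
end
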